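/- arXiv:1905.12730 — 3 statements merged into one kernel-verified Lean document; each statement's English description precedes it below -/
import Mathlib

section
/- Prototype A attribute recovery (Claim): For every constant k ≥ 1 there exist constants C ≥ 1 and c > 0 such that the following holds. Let N ≥ 2, let d ≤ N^k, let m ≤ N, let x₁, …, x_m ∈ ℝ^d be unit vectors, and let w₁, …, w_m ≥ 0 with Σᵢ wᵢ = 1. Let R₁, …, R_m be independent Haar-random elements of the orthogonal group O(d), and let s = Σᵢ wᵢ·Rᵢxᵢ. Then for every index i* with w_{i*} > 0: Pr[ ‖(1/w_{i*})·R_{i*}ᵀ s − x_{i*}‖_∞ > C·(log N)/(w_{i*}·√d) ] ≤ N^{−c}. -/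
open MeasureTheory Matrix

noncomputable instance (d : ℕ) : MeasurableSpace (Matrix.orthogonalGroup (Fin d) ℝ) :=
  borel _

instance (d : ℕ) : BorelSpace (Matrix.orthogonalGroup (Fin d) ℝ) := ⟨rfl⟩

/-- The squared Euclidean norm `‖v‖²` on `ℝ^d`. -/
def sqNorm {d : ℕ} (v : Fin d → ℝ) : ℝ := ∑ i, v i ^ 2

/-- The `ℓ∞` norm (maximum absolute coordinate) on `ℝ^d`. -/
noncomputable def linf {d : ℕ} (v : Fin d → ℝ) : ℝ := ⨆ i, |v i|


lemma householder {d : ℕ} (x y : Fin d → ℝ) (hx : x ⬝ᵥ x = 1) (hy : y ⬝ᵥ y = 1) :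
    ∃ Q : Matrix.orthogonalGroup (Fin d) ℝ, (Q : Matrix (Fin d) (Fin d) ℝ) *ᵥ x = y := by
  by_cases hv : x - y = 0
  · refine ⟨1, ?_⟩
    simp [sub_eq_zero.mp hv]
  set v := x - y with hvdef
  have hc : v ⬝ᵥ v ≠ 0 := fun h => hv (dotProduct_self_eq_zero.mp h)
  have hc2 : v ⬝ᵥ v = 2 * (v ⬝ᵥ x) := by
    simp only [hvdef, sub_dotProduct, dotProduct_sub, hx, hy, dotProduct_comm y x]
    ring
  refine ⟨⟨1 - (2 / (v ⬝ᵥ v)) • vecMulVec v v, ?_⟩, ?_⟩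
  · rw [Matrix.mem_orthogonalGroup_iff]
    have h1 : vecMulVec v v * vecMulVec v v = (v ⬝ᵥ v) • vecMulVec v v := by
      rw [vecMulVec_mul_vecMulVec]
      ext i j
      simp [vecMulVec_apply]
      ring
    have h2 : (vecMulVec v v)ᵀ = vecMulVec v v := by
      ext i j
      simp [vecMulVec_apply, mul_comm]
    rw [transpose_sub, transpose_smul, transpose_one, h2, sub_mul, mul_sub, mul_sub, one_mul,
      one_mul, mul_one, smul_mul_smul_comm, h1, smul_smul]
    have : 2 / (v ⬝ᵥ v) * (2 / (v ⬝ᵥ v)) * (v ⬝ᵥ v) = 2 / (v ⬝ᵥ v) + 2 / (v ⬝ᵥ v) := by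
      field_simp
      ring
    rw [this, add_smul]
    abel
  · have h3 : 2 / (v ⬝ᵥ v) * (v ⬝ᵥ x) = 1 := by
      rw [hc2] at hc ⊢
      field_simp at hc ⊢
      exact div_self (by simpa using hc)
    ext i
    have h4 : (vecMulVec v v *ᵥ x) i = v i * (v ⬝ᵥ x) := by
      simp [vecMulVec_mulVec, mul_comm]
    simp only [sub_mulVec, one_mulVec, smul_mulVec, Pi.sub_apply, Pi.smul_apply, h4, smul_eq_mul]
    have : 2 / (v ⬝ᵥ v) * (v i * (v ⬝ᵥ x)) = v i := by
      calc _ = (2 / (v ⬝ᵥ v) * (v ⬝ᵥ x)) * v i := by ring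
        _ = v i := by rw [h3, one_mul]
    rw [this, hvdef]
    simp

/-- sign of a Boolean -/
def bsgn (b : Bool) : ℝ := if b then 1 else -1

lemma bool_sign_sum {d : ℕ} (b : Fin d → ℝ) (hb : b ⬝ᵥ b = 1) :
    ∑ e : Fin d → Bool, Real.exp (b ⬝ᵥ fun j => bsgn (e j)) ≤ 2 ^ d * Real.exp (1 / 2) := by
  have h1 : ∑ e : Fin d → Bool, Real.exp (b ⬝ᵥ fun j => bsgn (e j))
      = ∏ j, (2 * Real.cosh (b j)) := by
    have := Finset.prod_univ_sum (fun _ : Fin d => (Finset.univ : Finset Bool))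
      (fun j e => Real.exp (b j * bsgn e))
    rw [Fintype.piFinset_univ] at this
    simp only [dotProduct, Real.exp_sum]
    rw [← this]
    refine Finset.prod_congr rfl fun j _ => ?_
    simp [bsgn, Real.cosh_eq]
    ring
  rw [h1, Finset.prod_mul_distrib]
  simp only [Finset.prod_const, Finset.card_univ, Fintype.card_fin]
  gcongr
  calc ∏ j, Real.cosh (b j) ≤ ∏ j, Real.exp (b j ^ 2 / 2) :=
        Finset.prod_le_prod (fun j _ => (Real.cosh_pos _).le)
          fun j _ => Real.cosh_le_exp_half_sq _
    _ = Real.exp (1 / 2) := by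
        rw [← Real.exp_sum, ← Finset.sum_div, ← hb]
        simp [dotProduct, sq]

instance orth_locallyCompact (d : ℕ) : LocallyCompactSpace (Matrix.orthogonalGroup (Fin d) ℝ) := by
  have h : IsClosed ((Matrix.orthogonalGroup (Fin d) ℝ : Set (Matrix (Fin d) (Fin d) ℝ))) :=
    isClosed_unitary
  have : LocallyCompactSpace (Matrix (Fin d) (Fin d) ℝ) :=
    inferInstanceAs (LocallyCompactSpace (Fin d → Fin d → ℝ))
  exact h.isClosedEmbedding_subtypeVal.locallyCompactSpace

lemma orth_rightInv {d : ℕ} (μ : Measure (Matrix.orthogonalGroup (Fin d) ℝ))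
    [μ.IsHaarMeasure] [IsProbabilityMeasure μ] : μ.IsMulRightInvariant := by
  refine ⟨fun g => ?_⟩
  have : IsProbabilityMeasure (μ.map (· * g)) :=
    Measure.isProbabilityMeasure_map (measurable_mul_const g).aemeasurable
  have : (μ.map (· * g)).IsHaarMeasure := Measure.isHaarMeasure_map_mul_right μ g
  exact Measure.isHaarMeasure_eq_of_isProbabilityMeasure _ _

/-- The random pairing. -/
def Zp {m d : ℕ} (i j : Fin m) (a x : Fin d → ℝ)
    (R : Fin m → Matrix.orthogonalGroup (Fin d) ℝ) : ℝ :=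
  ((R i : Matrix (Fin d) (Fin d) ℝ) *ᵥ a) ⬝ᵥ ((R j : Matrix (Fin d) (Fin d) ℝ) *ᵥ x)

lemma measurable_entry {m d : ℕ} (i : Fin m) (p q : Fin d) :
    Measurable fun R : Fin m → Matrix.orthogonalGroup (Fin d) ℝ =>
      (R i : Matrix (Fin d) (Fin d) ℝ) p q := by
  have h : Continuous fun A : Matrix.orthogonalGroup (Fin d) ℝ =>
      (A : Matrix (Fin d) (Fin d) ℝ) p q :=
    (continuous_apply_apply p q).comp continuous_subtype_val
  exact h.measurable.comp (measurable_pi_apply i)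

lemma measurable_Zp {m d : ℕ} (i j : Fin m) (a x : Fin d → ℝ) : Measurable (Zp i j a x) := by
  unfold Zp
  simp only [dotProduct, mulVec]
  refine Finset.measurable_sum _ fun p _ => Measurable.mul ?_ ?_
  · exact Finset.measurable_sum _ fun q _ => (measurable_entry i p q).mul_const _
  · exact Finset.measurable_sum _ fun q _ => (measurable_entry j p q).mul_const _

lemma orth_norm {d : ℕ} (A : Matrix.orthogonalGroup (Fin d) ℝ) (a : Fin d → ℝ) :
    ((A : Matrix (Fin d) (Fin d) ℝ) *ᵥ a) ⬝ᵥ ((A : Matrix (Fin d) (Fin d) ℝ) *ᵥ a) = a ⬝ᵥ a := by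
  have h := (Matrix.mem_orthogonalGroup_iff' _ _).mp A.2
  rw [dotProduct_mulVec, ← mulVec_transpose, mulVec_mulVec, h, one_mulVec]

lemma orth_norm_transpose {d : ℕ} (A : Matrix.orthogonalGroup (Fin d) ℝ) (a : Fin d → ℝ) :
    ((A : Matrix (Fin d) (Fin d) ℝ)ᵀ *ᵥ a) ⬝ᵥ ((A : Matrix (Fin d) (Fin d) ℝ)ᵀ *ᵥ a)
      = a ⬝ᵥ a := by
  have h := (Matrix.mem_orthogonalGroup_iff _ _).mp A.2
  rw [dotProduct_mulVec, ← mulVec_transpose, mulVec_mulVec, transpose_transpose, h, one_mulVec]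

lemma mgf_bound {m d : ℕ} (hd : 0 < d) (μ : Measure (Matrix.orthogonalGroup (Fin d) ℝ))
    [μ.IsHaarMeasure] [IsProbabilityMeasure μ] (i j : Fin m) (hij : i ≠ j)
    (a x : Fin d → ℝ) (ha : a ⬝ᵥ a = 1) (hx : x ⬝ᵥ x = 1) :
    ∫⁻ R, ENNReal.ofReal (Real.exp (Real.sqrt d * Zp i j a x R))
      ∂(Measure.pi fun _ : Fin m => μ) ≤ ENNReal.ofReal (Real.exp (1 / 2)) := by
  have := orth_rightInv μ
  have hd' : (0 : ℝ) < Real.sqrt d := Real.sqrt_pos.mpr (by exact_mod_cast hd)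
  have hdd : Real.sqrt d * Real.sqrt d = d := Real.mul_self_sqrt (by positivity)
  have hsg : ∀ e : Fin d → Bool, ∃ Q : Matrix.orthogonalGroup (Fin d) ℝ,
      (Q : Matrix (Fin d) (Fin d) ℝ) *ᵥ x = (Real.sqrt d)⁻¹ • fun l => bsgn (e l) := by
    intro e
    apply householder _ _ hx
    have h1 : ∀ b : Bool, bsgn b * bsgn b = 1 := by
      intro b
      cases b <;> simp [bsgn]
    have h2 : ((fun l => bsgn (e l)) ⬝ᵥ fun l => bsgn (e l)) = (d : ℝ) := by
      simp [dotProduct, h1]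
    rw [smul_dotProduct, dotProduct_smul, h2, smul_eq_mul, smul_eq_mul]
    field_simp
    rw [sq, hdd]
  choose Q hQ using hsg
  set P := Measure.pi fun _ : Fin m => μ with hP
  set f : (Fin m → Matrix.orthogonalGroup (Fin d) ℝ) → ENNReal :=
    fun R => ENNReal.ofReal (Real.exp (Real.sqrt d * Zp i j a x R)) with hf
  have hfm : Measurable f :=
    ENNReal.measurable_ofReal.comp (Real.measurable_exp.comp
      ((measurable_Zp i j a x).const_mul _))
  have key : ∀ (e : Fin d → Bool) (R : Fin m → Matrix.orthogonalGroup (Fin d) ℝ),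
      f (R * Pi.mulSingle j (Q e)) = ENNReal.ofReal (Real.exp
        (((R j : Matrix (Fin d) (Fin d) ℝ)ᵀ *ᵥ ((R i : Matrix (Fin d) (Fin d) ℝ) *ᵥ a)) ⬝ᵥ
          fun l => bsgn (e l))) := by
    intro e R
    simp only [hf, Zp, Pi.mul_apply, Pi.mulSingle_eq_same, Pi.mulSingle_eq_of_ne hij, mul_one,
      Submonoid.coe_mul]
    rw [← mulVec_mulVec, hQ, mulVec_smul, dotProduct_smul, smul_eq_mul, ← mul_assoc,
      mul_inv_cancel₀ hd'.ne', one_mul, dotProduct_mulVec, ← mulVec_transpose]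
  have hsum : (2 : ENNReal) ^ d * ∫⁻ R, f R ∂P
      ≤ (2 : ENNReal) ^ d * ENNReal.ofReal (Real.exp (1 / 2)) := by
    calc (2 : ENNReal) ^ d * ∫⁻ R, f R ∂P
        = ∑ e : Fin d → Bool, ∫⁻ R, f (R * Pi.mulSingle j (Q e)) ∂P := by
          simp_rw [lintegral_mul_right_eq_self]
          simp
      _ = ∫⁻ R, ∑ e : Fin d → Bool, f (R * Pi.mulSingle j (Q e)) ∂P := by
          rw [lintegral_finsetSum]
          intro e _
          exact hfm.comp (measurable_mul_const _)
      _ ≤ ∫⁻ R, (2 : ENNReal) ^ d * ENNReal.ofReal (Real.exp (1 / 2)) ∂P := by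
          refine lintegral_mono fun R => ?_
          simp only [key]
          rw [← ENNReal.ofReal_sum_of_nonneg (fun _ _ => (Real.exp_pos _).le)]
          refine (ENNReal.ofReal_le_ofReal (bool_sign_sum _ ?_)).trans ?_
          · rw [orth_norm_transpose, orth_norm, ha]
          · rw [ENNReal.ofReal_mul (by positivity), ENNReal.ofReal_pow (by norm_num)]
            simp
      _ = _ := by simp
  exact (ENNReal.mul_le_mul_iff_right (by simp) (by simp)).mp hsum

lemma tail_one {m d : ℕ} (hd : 0 < d) (μ : Measure (Matrix.orthogonalGroup (Fin d) ℝ))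
    [μ.IsHaarMeasure] [IsProbabilityMeasure μ] (i j : Fin m) (hij : i ≠ j)
    (a x : Fin d → ℝ) (ha : a ⬝ᵥ a = 1) (hx : x ⬝ᵥ x = 1) (t : ℝ) :
    (Measure.pi fun _ : Fin m => μ) {R | t / Real.sqrt d < Zp i j a x R}
      ≤ ENNReal.ofReal (2 * Real.exp (-t)) := by
  have hd' : (0 : ℝ) < Real.sqrt d := Real.sqrt_pos.mpr (by exact_mod_cast hd)
  have hfm : Measurable fun R : Fin m → Matrix.orthogonalGroup (Fin d) ℝ =>
      ENNReal.ofReal (Real.exp (Real.sqrt d * Zp i j a x R)) :=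
    ENNReal.measurable_ofReal.comp (Real.measurable_exp.comp
      ((measurable_Zp i j a x).const_mul _))
  have h1 := meas_ge_le_lintegral_div (μ := Measure.pi fun _ : Fin m => μ) hfm.aemeasurable
    (ε := ENNReal.ofReal (Real.exp t)) (by simp [Real.exp_pos]) (by simp)
  have hsub : {R : Fin m → Matrix.orthogonalGroup (Fin d) ℝ | t / Real.sqrt d < Zp i j a x R} ⊆
      {R | ENNReal.ofReal (Real.exp t) ≤
        ENNReal.ofReal (Real.exp (Real.sqrt d * Zp i j a x R))} := by
    intro R hR
    have hR' : t / Real.sqrt d < Zp i j a x R := hR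
    rw [div_lt_iff₀ hd'] at hR'
    exact ENNReal.ofReal_le_ofReal (Real.exp_le_exp.mpr (by linarith))
  have he : Real.exp (1 / 2) ≤ 2 := by
    have h := Real.exp_one_lt_d9
    have h2 : Real.exp (1 / 2) * Real.exp (1 / 2) = Real.exp 1 := by
      rw [← Real.exp_add]
      norm_num
    nlinarith [Real.exp_pos (1 / 2)]
  calc _ ≤ _ := measure_mono hsub
    _ ≤ _ := h1
    _ ≤ ENNReal.ofReal (Real.exp (1 / 2)) / ENNReal.ofReal (Real.exp t) :=
        ENNReal.div_le_div_right (mgf_bound hd μ i j hij a x ha hx) _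
    _ ≤ _ := by
        rw [← ENNReal.ofReal_div_of_pos (Real.exp_pos _), Real.exp_neg, div_eq_mul_inv]
        apply ENNReal.ofReal_le_ofReal
        gcongr

lemma tail_abs {m d : ℕ} (hd : 0 < d) (μ : Measure (Matrix.orthogonalGroup (Fin d) ℝ))
    [μ.IsHaarMeasure] [IsProbabilityMeasure μ] (i j : Fin m) (hij : i ≠ j)
    (a x : Fin d → ℝ) (ha : a ⬝ᵥ a = 1) (hx : x ⬝ᵥ x = 1) (t : ℝ) :
    (Measure.pi fun _ : Fin m => μ) {R | t / Real.sqrt d < |Zp i j a x R|}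
      ≤ ENNReal.ofReal (4 * Real.exp (-t)) := by
  have hsub : {R : Fin m → Matrix.orthogonalGroup (Fin d) ℝ | t / Real.sqrt d < |Zp i j a x R|} ⊆
      {R | t / Real.sqrt d < Zp i j a x R} ∪ {R | t / Real.sqrt d < Zp i j a (-x) R} := by
    intro R hR
    have hR' : t / Real.sqrt d < |Zp i j a x R| := hR
    rcases lt_abs.mp hR' with h | h
    · exact Or.inl h
    · right
      simpa [Zp, mulVec_neg] using h
  refine (measure_mono hsub).trans ((measure_union_le _ _).trans ?_)
  refine (add_le_add (tail_one hd μ i j hij a x ha hx t)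
    (tail_one hd μ i j hij a (-x) ha (by simpa using hx) t)).trans ?_
  rw [← ENNReal.ofReal_add (by positivity) (by positivity)]
  apply ENNReal.ofReal_le_ofReal
  linarith

lemma coord_eq {m d : ℕ} (x : Fin m → Fin d → ℝ) (w : Fin m → ℝ) (s : Fin m) (hs : 0 < w s)
    (R : Fin m → Matrix.orthogonalGroup (Fin d) ℝ) (l : Fin d) :
    ((w s)⁻¹ • (R s : Matrix (Fin d) (Fin d) ℝ)ᵀ.mulVec
        (∑ i, w i • (R i : Matrix (Fin d) (Fin d) ℝ).mulVec (x i)) - x s) l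
      = (w s)⁻¹ * ∑ i ∈ Finset.univ.erase s, w i * Zp s i (Pi.single l 1) (x i) R := by
  have hZ : ∀ y : Fin d → ℝ, ((R s : Matrix (Fin d) (Fin d) ℝ)ᵀ *ᵥ y) l
      = ((R s : Matrix (Fin d) (Fin d) ℝ) *ᵥ Pi.single l 1) ⬝ᵥ y := by
    intro y
    rw [mulVec_single_one]
    rfl
  have hZs : Zp s s (Pi.single l 1) (x s) R = x s l := by
    have h := (Matrix.mem_orthogonalGroup_iff' _ _).mp (R s).2
    rw [Zp, ← hZ, mulVec_mulVec, h, one_mulVec]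
  have hfull : ((R s : Matrix (Fin d) (Fin d) ℝ)ᵀ.mulVec
        (∑ i, w i • (R i : Matrix (Fin d) (Fin d) ℝ).mulVec (x i))) l
      = ∑ i, w i * Zp s i (Pi.single l 1) (x i) R := by
    rw [hZ, dotProduct_sum]
    simp [Zp]
  rw [Pi.sub_apply, Pi.smul_apply, hfull, ← Finset.add_sum_erase _ _ (Finset.mem_univ s), hZs,
    smul_eq_mul]
  field_simp
  ring

/-- **Prototype A attribute recovery.** For every constant `k ≥ 1` there are constants
`C ≥ 1`, `c > 0` such that: for `N ≥ 2`, `d ≤ N^k`, `m ≤ N`, unit vectors `x₁,…,x_m ∈ ℝ^d`,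
nonnegative weights summing to `1`, and `R₁,…,R_m` independent Haar-random orthogonal
matrices, setting `s = Σᵢ wᵢ·Rᵢxᵢ`, for every index `i⋆` with `w_{i⋆} > 0`,
`Pr[ ‖(1/w_{i⋆})·R_{i⋆}ᵀ s − x_{i⋆}‖_∞ > C·(log N)/(w_{i⋆}·√d) ] ≤ N^{−c}`. -/
theorem prototypeA_attribute_recovery (k : ℕ) (hk : 1 ≤ k) :
    ∃ C : ℝ, 1 ≤ C ∧ ∃ c : ℝ, 0 < c ∧
      ∀ (N d m : ℕ), 2 ≤ N → d ≤ N ^ k → m ≤ N →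
      ∀ x : Fin m → Fin d → ℝ, (∀ i, sqNorm (x i) = 1) →
      ∀ w : Fin m → ℝ, (∀ i, 0 ≤ w i) → (∑ i, w i) = 1 →
      ∀ μ : Measure (Matrix.orthogonalGroup (Fin d) ℝ),
        μ.IsHaarMeasure → IsProbabilityMeasure μ →
      ∀ istar : Fin m, 0 < w istar →
        (Measure.pi fun _ : Fin m => μ)
            {R : Fin m → Matrix.orthogonalGroup (Fin d) ℝ |
              C * Real.log N / (w istar * Real.sqrt d) <
                linf ((w istar)⁻¹ •
                    (R istar : Matrix (Fin d) (Fin d) ℝ)ᵀ.mulVec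
                      (∑ i, w i • (R i : Matrix (Fin d) (Fin d) ℝ).mulVec (x i))
                  - x istar)}
          ≤ ENNReal.ofReal ((N : ℝ) ^ (-c : ℝ)) := by
  refine ⟨(k : ℝ) + 4, by linarith [(Nat.cast_nonneg k : (0 : ℝ) ≤ k)], 1, one_pos, ?_⟩
  intro N d m hN hdN hmN x hx w hw hw1 μ hμ hμp s hs
  have hx' : ∀ i, x i ⬝ᵥ x i = 1 := by
    intro i
    rw [← hx i]
    simp [sqNorm, dotProduct, sq]
  have hd : 0 < d := by
    rcases Nat.eq_zero_or_pos d with h | h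
    · subst h
      have := hx s
      simp [sqNorm] at this
    · exact h
  have : Nonempty (Fin d) := ⟨⟨0, hd⟩⟩
  have hd' : (0 : ℝ) < Real.sqrt d := Real.sqrt_pos.mpr (by exact_mod_cast hd)
  have hN2 : (2 : ℝ) ≤ N := by exact_mod_cast hN
  have hN0 : (0 : ℝ) < N := by linarith
  have hlog : 0 ≤ Real.log N := Real.log_nonneg (by linarith)
  set t : ℝ := ((k : ℝ) + 4) * Real.log N with ht
  have ht0 : 0 ≤ t := by positivity
  have hsub : {R : Fin m → Matrix.orthogonalGroup (Fin d) ℝ |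
              t / (w s * Real.sqrt d) <
                linf ((w s)⁻¹ •
                    (R s : Matrix (Fin d) (Fin d) ℝ)ᵀ.mulVec
                      (∑ i, w i • (R i : Matrix (Fin d) (Fin d) ℝ).mulVec (x i))
                  - x s)} ⊆
      ⋃ i ∈ Finset.univ.erase s, ⋃ l ∈ (Finset.univ : Finset (Fin d)),
        {R | t / Real.sqrt d < |Zp s i (Pi.single l 1) (x i) R|} := by
    intro R hR
    by_contra hcon
    simp only [Set.mem_iUnion, Set.mem_ofPred_eq, not_exists, not_lt] at hcon
    rw [Set.mem_ofPred_eq] at hR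
    refine absurd hR (not_lt.mpr ?_)
    refine ciSup_le fun l => ?_
    rw [coord_eq x w s hs, abs_mul, abs_of_pos (inv_pos.mpr hs)]
    have h1 : |∑ i ∈ Finset.univ.erase s, w i * Zp s i (Pi.single l 1) (x i) R|
        ≤ t / Real.sqrt d := by
      calc _ ≤ ∑ i ∈ Finset.univ.erase s, |w i * Zp s i (Pi.single l 1) (x i) R| :=
            Finset.abs_sum_le_sum_abs _ _
        _ ≤ ∑ i ∈ Finset.univ.erase s, w i * (t / Real.sqrt d) := by
            refine Finset.sum_le_sum fun i hi => ?_
            rw [abs_mul, abs_of_nonneg (hw i)]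
            exact mul_le_mul_of_nonneg_left (hcon i hi l (Finset.mem_univ l)) (hw i)
        _ ≤ ∑ i, w i * (t / Real.sqrt d) :=
            Finset.sum_le_sum_of_subset_of_nonneg (Finset.erase_subset _ _)
              fun i _ _ => mul_nonneg (hw i) (by positivity)
        _ = t / Real.sqrt d := by rw [← Finset.sum_mul, hw1, one_mul]
    calc _ ≤ (w s)⁻¹ * (t / Real.sqrt d) :=
          mul_le_mul_of_nonneg_left h1 (inv_pos.mpr hs).le
      _ = _ := by
          field_simp
  refine (measure_mono hsub).trans ?_
  have hbound : ∀ i ∈ Finset.univ.erase s, (Measure.pi fun _ : Fin m => μ)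
      (⋃ l ∈ (Finset.univ : Finset (Fin d)),
        {R | t / Real.sqrt d < |Zp s i (Pi.single l 1) (x i) R|})
      ≤ (d : ENNReal) * ENNReal.ofReal (4 * Real.exp (-t)) := by
    intro i hi
    refine (measure_biUnion_finset_le _ _).trans ?_
    refine (Finset.sum_le_sum fun l _ => tail_abs hd μ s i (Finset.ne_of_mem_erase hi).symm
      (Pi.single l 1) (x i) (by simp) (hx' i) t).trans ?_
    simp
  refine (measure_biUnion_finset_le _ _).trans ((Finset.sum_le_sum hbound).trans ?_)
  rw [Finset.sum_const, nsmul_eq_mul]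
  have hcard : ((Finset.univ.erase s).card : ENNReal) ≤ (N : ENNReal) := by
    have : (Finset.univ.erase s).card ≤ N :=
      (Finset.card_le_card (Finset.erase_subset _ _)).trans (by simpa using hmN)
    exact_mod_cast this
  have hdc : (d : ENNReal) ≤ ((N ^ k : ℕ) : ENNReal) := by exact_mod_cast hdN
  refine (mul_le_mul' hcard (mul_le_mul' hdc le_rfl)).trans ?_
  rw [← ENNReal.ofReal_natCast N, ← ENNReal.ofReal_natCast (N ^ k),
    ← ENNReal.ofReal_mul (by positivity), ← ENNReal.ofReal_mul (by positivity)]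
  apply ENNReal.ofReal_le_ofReal
  have hexp : Real.exp (-t) = ((N : ℝ) ^ (k + 4))⁻¹ := by
    rw [Real.exp_neg, ht, mul_comm, Real.exp_mul, Real.exp_log hN0]
    congr 1
    rw [← Real.rpow_natCast]
    push_cast
    rfl
  rw [hexp, Real.rpow_neg_one]
  push_cast
  have : (N : ℝ) * ((N : ℝ) ^ k * (4 * ((N : ℝ) ^ (k + 4))⁻¹)) = 4 / (N ^ 2) * (N : ℝ)⁻¹ := by
    rw [pow_add]
    field_simp
  rw [this]
  have h4 : 4 / (N : ℝ) ^ 2 ≤ 1 := by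
    rw [div_le_one (by positivity)]
    nlinarith
  exact mul_le_of_le_one_left (by positivity) h4
end

section
/- Prototype A sketch-to-sketch similarity, case (ii) (sketches sharing an object are similar): There exist constants C ≥ 1 and c > 0 such that the following holds. Let N ≥ 2, d ≥ 1, let R₁, …, R_N be independent Haar-random elements of O(d), let A, Ā ⊆ {1,…,N}, let xᵢ (i ∈ A) and x̄ᵢ (i ∈ Ā) be unit vectors in ℝ^d all of whose coordinates are nonnegative, and let wᵢ ≥ 0 (i ∈ A) and w̄ᵢ ≥ 0 (i ∈ Ā) each sum to 1. Set s = Σ_{i∈A} wᵢRᵢxᵢ and s̄ = Σ_{i∈Ā} w̄ᵢRᵢx̄ᵢ. If there is an index i* ∈ A ∩ Ā with x_{i*} = x̄_{i*}, then Pr[ ⟨s, s̄⟩ < w_{i*}·w̄_{i*} − C·√(log N)/√d ] ≤ N^{−c}. -/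
open MeasureTheory Matrix

/-- The standard inner product on `ℝ^d`. -/
def ip {d : ℕ} (v w : Fin d → ℝ) : ℝ := ∑ i, v i * w i

lemma ip_eq_dot {d : ℕ} (v w : Fin d → ℝ) : ip v w = v ⬝ᵥ w := rfl

lemma sqNorm_eq_dot {d : ℕ} (v : Fin d → ℝ) : sqNorm v = v ⬝ᵥ v := by
  simp [sqNorm, dotProduct, sq]

lemma exists_householder {d : ℕ} (v w : Fin d → ℝ) (hv : sqNorm v = 1) (hw : sqNorm w = 1) :
    ∃ Q : Matrix.orthogonalGroup (Fin d) ℝ,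
      ∀ y, ip ((Q : Matrix (Fin d) (Fin d) ℝ).mulVec y) v = ip y w := by
  rw [sqNorm_eq_dot] at hv hw
  by_cases h : v = w
  · exact ⟨1, fun y => by simp [h]⟩
  set u := v - w with hu
  have hu0 : u ⬝ᵥ u ≠ 0 := by
    intro h0
    exact h (sub_eq_zero.mp (dotProduct_self_eq_zero.mp h0))
  have huu : u ⬝ᵥ u = 2 * (v ⬝ᵥ u) := by
    simp only [hu, sub_dotProduct, dotProduct_sub, hv, hw, dotProduct_comm w v]; ring
  set H : Matrix (Fin d) (Fin d) ℝ := 1 - (2 / (u ⬝ᵥ u)) • vecMulVec u u with hH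
  have hmv : ∀ y, H.mulVec y = y - (2 / (u ⬝ᵥ u) * (u ⬝ᵥ y)) • u := by
    intro y
    rw [hH, sub_mulVec, one_mulVec, smul_mulVec, vecMulVec_mulVec]
    ext k; simp; ring
  have hT : Hᵀ = H := by
    rw [hH]; simp [transpose_sub, transpose_smul, transpose_vecMulVec]
  have hHH : H * H = 1 := by
    apply Matrix.ext_of_mulVec_single
    intro i
    rw [← mulVec_mulVec, hmv, hmv, one_mulVec]
    simp only [dotProduct_sub, dotProduct_smul, smul_eq_mul]
    ext k
    simp
    field_simp
    ring
  refine ⟨⟨H, ?_⟩, fun y => ?_⟩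
  · rw [mem_orthogonalGroup_iff, hT, hHH]
  · simp only [ip_eq_dot]
    rw [hmv, sub_dotProduct, smul_dotProduct, dotProduct_comm u v |>.trans rfl, smul_eq_mul]
    have : 2 / (u ⬝ᵥ u) * (u ⬝ᵥ y) * (v ⬝ᵥ u) = u ⬝ᵥ y := by
      rw [huu] at hu0 ⊢
      have : v ⬝ᵥ u ≠ 0 := by intro h0; apply hu0; rw [h0]; ring
      field_simp
    rw [this, hu, sub_dotProduct, dotProduct_comm v y, dotProduct_comm w y]; ring

lemma sqNorm_mulVec {d : ℕ} (R : Matrix.orthogonalGroup (Fin d) ℝ) (x : Fin d → ℝ) :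
    sqNorm ((R : Matrix (Fin d) (Fin d) ℝ).mulVec x) = sqNorm x := by
  rw [sqNorm_eq_dot, sqNorm_eq_dot, dotProduct_mulVec, vecMul_mulVec]
  have := (mem_orthogonalGroup_iff' (Fin d) ℝ).1 R.2
  rw [this, vecMul_one]

lemma ip_mulVec_mulVec {d : ℕ} (R : Matrix.orthogonalGroup (Fin d) ℝ) (x y : Fin d → ℝ) :
    ip ((R : Matrix (Fin d) (Fin d) ℝ).mulVec x) ((R : Matrix (Fin d) (Fin d) ℝ).mulVec y)
      = ip x y := by
  rw [ip_eq_dot, ip_eq_dot, dotProduct_mulVec, vecMul_mulVec]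
  have := (mem_orthogonalGroup_iff' (Fin d) ℝ).1 R.2
  rw [this, vecMul_one]

lemma meas_mulVec {d : ℕ} (x : Fin d → ℝ) (k : Fin d) :
    Measurable (fun R : Matrix.orthogonalGroup (Fin d) ℝ =>
      (R : Matrix (Fin d) (Fin d) ℝ).mulVec x k) := by
  apply Continuous.measurable
  have : Continuous (fun R : Matrix.orthogonalGroup (Fin d) ℝ =>
      (R : Matrix (Fin d) (Fin d) ℝ).mulVec x) :=
    Continuous.matrix_mulVec continuous_subtype_val continuous_const
  exact (continuous_apply k).comp this

lemma rademacher_sum_le {d : ℕ} (hd : 1 ≤ d) (l : ℝ) (y : Fin d → ℝ) (hy : sqNorm y = 1) :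
    ∑ e ∈ Fintype.piFinset (fun _ : Fin d => ({1, -1} : Finset ℝ)),
      Real.exp (l * ip y (fun k => e k / √d)) ≤ 2 ^ d * Real.exp (l ^ 2 / (2 * d)) := by
  have hd0 : (0 : ℝ) < d := by exact_mod_cast hd
  have h1 : ∀ e : Fin d → ℝ, Real.exp (l * ip y (fun k => e k / √d))
      = ∏ k, Real.exp (l * y k / √d * e k) := by
    intro e
    rw [← Real.exp_sum, ip, Finset.mul_sum]
    congr 1
    apply Finset.sum_congr rfl
    intro k _
    ring
  simp_rw [h1]
  rw [← Finset.prod_univ_sum (fun _ : Fin d => ({1, -1} : Finset ℝ))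
    (fun k a => Real.exp (l * y k / √d * a))]
  have h2 : ∀ k, ∑ a ∈ ({1, -1} : Finset ℝ), Real.exp (l * y k / √d * a)
      ≤ 2 * Real.exp (l ^ 2 / (2 * d) * y k ^ 2) := by
    intro k
    rw [Finset.sum_pair (by norm_num)]
    have := Real.cosh_le_exp_half_sq (l * y k / √d)
    rw [Real.cosh_eq] at this
    have e : (l * y k / √d) ^ 2 / 2 = l ^ 2 / (2 * d) * y k ^ 2 := by
      rw [div_pow, mul_pow, Real.sq_sqrt hd0.le]; field_simp
    rw [e] at this
    rw [mul_one, mul_neg_one]; linarith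
  calc _ ≤ ∏ k, (2 * Real.exp (l ^ 2 / (2 * d) * y k ^ 2)) :=
        Finset.prod_le_prod (fun k _ => Finset.sum_nonneg fun _ _ => (Real.exp_pos _).le)
          (fun k _ => h2 k)
    _ = _ := by
        rw [Finset.prod_mul_distrib, ← Real.exp_sum, ← Finset.mul_sum]
        change _ * Real.exp (_ * sqNorm y) = _
        rw [hy]; simp

lemma mgf_bound_s14 {d : ℕ} (hd : 1 ≤ d) (μ : Measure (Matrix.orthogonalGroup (Fin d) ℝ))
    [μ.IsHaarMeasure] [IsProbabilityMeasure μ] (l : ℝ) (x v : Fin d → ℝ)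
    (hx : sqNorm x = 1) (hv : sqNorm v = 1) :
    ∫⁻ R, ENNReal.ofReal (Real.exp (l * ip ((R : Matrix (Fin d) (Fin d) ℝ).mulVec x) v)) ∂μ
      ≤ ENNReal.ofReal (Real.exp (l ^ 2 / (2 * d))) := by
  have hd0 : (0 : ℝ) < d := by exact_mod_cast hd
  set P := Fintype.piFinset (fun _ : Fin d => ({1, -1} : Finset ℝ)) with hP
  set I := ∫⁻ R, ENNReal.ofReal
    (Real.exp (l * ip ((R : Matrix (Fin d) (Fin d) ℝ).mulVec x) v)) ∂μ with hI
  have hmeas : ∀ w : Fin d → ℝ, Measurable (fun R : Matrix.orthogonalGroup (Fin d) ℝ =>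
      ENNReal.ofReal (Real.exp (l * ip ((R : Matrix (Fin d) (Fin d) ℝ).mulVec x) w))) := by
    intro w
    refine (Real.measurable_exp.comp (Measurable.const_mul ?_ l)).ennreal_ofReal
    exact Finset.measurable_sum _ fun k _ => (meas_mulVec x k).mul_const _
  have hinv : ∀ e ∈ P, ∫⁻ R, ENNReal.ofReal (Real.exp (l *
      ip ((R : Matrix (Fin d) (Fin d) ℝ).mulVec x) (fun k => e k / √d))) ∂μ = I := by
    intro e he
    have hw : sqNorm (fun k => e k / √d) = 1 := by
      have : ∀ k, (e k / √d) ^ 2 = 1 / d := by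
        intro k
        have := Fintype.mem_piFinset.1 he k
        rw [div_pow, Real.sq_sqrt hd0.le]
        simp only [Finset.mem_insert, Finset.mem_singleton] at this
        rcases this with h | h <;> simp [h]
      simp [sqNorm, this, hd0.ne']
    obtain ⟨Q, hQ⟩ := exists_householder v _ hv hw
    rw [hI, ← lintegral_mul_left_eq_self (fun R : Matrix.orthogonalGroup (Fin d) ℝ =>
      ENNReal.ofReal (Real.exp (l * ip ((R : Matrix (Fin d) (Fin d) ℝ).mulVec x) v))) Q]
    simp only [Submonoid.coe_mul, ← mulVec_mulVec, hQ]
  have hcard : P.card = 2 ^ d := by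
    rw [hP, Fintype.card_piFinset]
    simp [Finset.card_pair (show (1 : ℝ) ≠ -1 by norm_num)]
  have key : (2 : ENNReal) ^ d * I ≤ 2 ^ d * ENNReal.ofReal (Real.exp (l ^ 2 / (2 * d))) := by
    calc (2 : ENNReal) ^ d * I = ∑ e ∈ P, ∫⁻ R, ENNReal.ofReal (Real.exp (l *
      ip ((R : Matrix (Fin d) (Fin d) ℝ).mulVec x) (fun k => e k / √d))) ∂μ := by
          rw [Finset.sum_congr rfl hinv, Finset.sum_const, hcard]; simp
      _ = ∫⁻ R, ∑ e ∈ P, ENNReal.ofReal (Real.exp (l *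
      ip ((R : Matrix (Fin d) (Fin d) ℝ).mulVec x) (fun k => e k / √d))) ∂μ := by
          rw [lintegral_finsetSum _ fun e _ => hmeas _]
      _ ≤ ∫⁻ R, ENNReal.ofReal (2 ^ d * Real.exp (l ^ 2 / (2 * d))) ∂μ := by
          apply lintegral_mono
          intro R
          dsimp only
          rw [← ENNReal.ofReal_sum_of_nonneg fun _ _ => (Real.exp_pos _).le]
          exact ENNReal.ofReal_le_ofReal (rademacher_sum_le hd l _ (by rw [sqNorm_mulVec, hx]))
      _ = _ := by
          rw [lintegral_const, measure_univ, mul_one, ENNReal.ofReal_mul (by positivity),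
            ENNReal.ofReal_pow (by norm_num)]
          simp
  exact (ENNReal.mul_le_mul_iff_right (by simp) (by simp)).1 key

lemma lintegral_pi_pair {N : ℕ} {O : Type*} [MeasurableSpace O] (μ : Measure O)
    [IsProbabilityMeasure μ] (G : O × O → ENNReal) (hG : Measurable G) (i j : Fin N)
    (hij : i ≠ j) :
    ∫⁻ R : Fin N → O, G (R j, R i) ∂(Measure.pi fun _ : Fin N => μ)
      = ∫⁻ q, ∫⁻ r, G (q, r) ∂μ ∂μ := by
  have hind : ProbabilityTheory.IndepFun (fun R : Fin N → O => R j) (fun R => R i)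
      (Measure.pi fun _ : Fin N => μ) :=
    (ProbabilityTheory.iIndepFun_pi (μ := fun _ : Fin N => μ) (X := fun _ (R : O) => R)
      (fun _ => aemeasurable_id)).indepFun hij.symm
  have hmap := (ProbabilityTheory.indepFun_iff_map_prod_eq_prod_map_map
    (measurable_pi_apply j).aemeasurable (measurable_pi_apply i).aemeasurable).1 hind
  have e1 : ∀ k, (Measure.pi fun _ : Fin N => μ).map (fun R => R k) = μ := fun k =>
    (measurePreserving_eval (fun _ : Fin N => μ) k).map_eq
  rw [e1, e1] at hmap
  rw [← lintegral_map hG ((measurable_pi_apply j).prodMk (measurable_pi_apply i)), hmap,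
    lintegral_prod _ hG.aemeasurable]

lemma mgf_pair {N d : ℕ} (hd : 1 ≤ d) (μ : Measure (Matrix.orthogonalGroup (Fin d) ℝ))
    [μ.IsHaarMeasure] [IsProbabilityMeasure μ] (l : ℝ) (x v : Fin d → ℝ)
    (hx : sqNorm x = 1) (hv : sqNorm v = 1) (i j : Fin N) (hij : i ≠ j) :
    ∫⁻ R : Fin N → Matrix.orthogonalGroup (Fin d) ℝ,
      ENNReal.ofReal (Real.exp (l * ip ((R i : Matrix (Fin d) (Fin d) ℝ).mulVec x)
        ((R j : Matrix (Fin d) (Fin d) ℝ).mulVec v))) ∂(Measure.pi fun _ : Fin N => μ)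
      ≤ ENNReal.ofReal (Real.exp (l ^ 2 / (2 * d))) := by
  have hG : Measurable (fun p : Matrix.orthogonalGroup (Fin d) ℝ × Matrix.orthogonalGroup (Fin d) ℝ =>
      ENNReal.ofReal (Real.exp (l * ip ((p.2 : Matrix (Fin d) (Fin d) ℝ).mulVec x)
        ((p.1 : Matrix (Fin d) (Fin d) ℝ).mulVec v)))) := by
    refine (Real.measurable_exp.comp (Measurable.const_mul ?_ l)).ennreal_ofReal
    exact Finset.measurable_sum _ fun k _ =>
      ((meas_mulVec x k).comp measurable_snd).mul ((meas_mulVec v k).comp measurable_fst)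
  rw [lintegral_pi_pair μ _ hG i j hij]
  have hb : ∀ Q : Matrix.orthogonalGroup (Fin d) ℝ,
      ∫⁻ R : Matrix.orthogonalGroup (Fin d) ℝ,
        ENNReal.ofReal (Real.exp (l * ip ((R : Matrix (Fin d) (Fin d) ℝ).mulVec x)
        ((Q : Matrix (Fin d) (Fin d) ℝ).mulVec v))) ∂μ
        ≤ ENNReal.ofReal (Real.exp (l ^ 2 / (2 * d))) := by
    intro Q
    have hQ : sqNorm ((Q : Matrix (Fin d) (Fin d) ℝ).mulVec v) = 1 := by
      rw [sqNorm_mulVec, hv]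
    exact mgf_bound_s14 hd μ l x _ hx hQ
  refine (lintegral_mono hb).trans ?_
  rw [lintegral_const, measure_univ, mul_one]

lemma ip_sum_sum {N d : ℕ} (A B : Finset (Fin N)) (w wb : Fin N → ℝ) (a b : Fin N → Fin d → ℝ) :
    ip (∑ i ∈ A, w i • a i) (∑ j ∈ B, wb j • b j)
      = ∑ p ∈ A ×ˢ B, w p.1 * wb p.2 * ip (a p.1) (b p.2) := by
  rw [Finset.sum_product, ip_eq_dot, sum_dotProduct]
  simp only [ip_eq_dot, dotProduct_sum, smul_dotProduct, dotProduct_smul,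
    smul_eq_mul]
  exact Finset.sum_congr rfl fun i _ => Finset.sum_congr rfl fun j _ => by ring

/-- **Prototype A sketch-to-sketch similarity, case (ii): sketches sharing an object are
similar.** There are constants `C ≥ 1`, `c > 0` such that: for `N ≥ 2`, `d ≥ 1`, independent
Haar-random orthogonal matrices `R₁,…,R_N`, module sets `A, Ā ⊆ {1,…,N}`, nonnegative unit
attribute vectors and nonnegative weights each summing to `1`, if some `i⋆ ∈ A ∩ Ā` has
`x_{i⋆} = x̄_{i⋆}` then the sketches `s = Σ_{i∈A} wᵢRᵢxᵢ` and `s̄ = Σ_{i∈Ā} w̄ᵢRᵢx̄ᵢ` satisfy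
`Pr[ ⟨s, s̄⟩ < w_{i⋆}·w̄_{i⋆} − C·√(log N)/√d ] ≤ N^{−c}`. -/
theorem prototypeA_similarity_shared_object :
    ∃ C : ℝ, 1 ≤ C ∧ ∃ c : ℝ, 0 < c ∧
      ∀ (N d : ℕ), 2 ≤ N → 1 ≤ d →
      ∀ A Abar : Finset (Fin N),
      ∀ x xbar : Fin N → Fin d → ℝ,
        (∀ i ∈ A, sqNorm (x i) = 1) → (∀ i ∈ Abar, sqNorm (xbar i) = 1) →
        (∀ i ∈ A, ∀ j, 0 ≤ x i j) → (∀ i ∈ Abar, ∀ j, 0 ≤ xbar i j) →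
      ∀ w wbar : Fin N → ℝ, (∀ i, 0 ≤ w i) → (∀ i, 0 ≤ wbar i) →
        (∑ i ∈ A, w i) = 1 → (∑ i ∈ Abar, wbar i) = 1 →
      ∀ μ : Measure (Matrix.orthogonalGroup (Fin d) ℝ),
        μ.IsHaarMeasure → IsProbabilityMeasure μ →
      ∀ istar : Fin N, istar ∈ A → istar ∈ Abar → x istar = xbar istar →
        (Measure.pi fun _ : Fin N => μ)
            {R : Fin N → Matrix.orthogonalGroup (Fin d) ℝ |
              ip (∑ i ∈ A, w i • (R i : Matrix (Fin d) (Fin d) ℝ).mulVec (x i))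
                  (∑ i ∈ Abar, wbar i • (R i : Matrix (Fin d) (Fin d) ℝ).mulVec (xbar i)) <
                w istar * wbar istar - C * Real.sqrt (Real.log N) / Real.sqrt d}
          ≤ ENNReal.ofReal ((N : ℝ) ^ (-c : ℝ)) := by
  refine ⟨1, le_rfl, 1 / 2, by norm_num, ?_⟩
  intro N d hN hd A B x xb hx hxb hx0 hxb0 w wb hw hwb hws hwbs μ hμ hμp s hsA hsB hs
  have hd0 : (0 : ℝ) < d := by exact_mod_cast hd
  have hN0 : (0 : ℝ) < N := by exact_mod_cast (by omega : 0 < N)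
  have hlog : 0 ≤ Real.log N := Real.log_natCast_nonneg N
  set t : ℝ := 1 * √(Real.log N) / √d with ht
  have ht0 : 0 ≤ t := by positivity
  have ht2 : t ^ 2 * d = Real.log N := by
    rw [ht, one_mul, div_pow, Real.sq_sqrt hlog, Real.sq_sqrt hd0.le]; field_simp
  set l : ℝ := t * d with hl
  have hl0 : 0 ≤ l := by positivity
  let g : Fin N × Fin N → (Fin N → Matrix.orthogonalGroup (Fin d) ℝ) → ℝ := fun p R =>
    if p.1 = p.2 then 0 else ip ((R p.1 : Matrix (Fin d) (Fin d) ℝ).mulVec (x p.1))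
      ((R p.2 : Matrix (Fin d) (Fin d) ℝ).mulVec (xb p.2))
  have hgm : ∀ p, Measurable (fun R => ENNReal.ofReal (Real.exp (-l * g p R))) := by
    intro p
    refine (Real.measurable_exp.comp (Measurable.const_mul ?_ (-l))).ennreal_ofReal
    by_cases h : p.1 = p.2
    · simp [g, h]
    · simp only [g, h, if_false]
      exact Finset.measurable_sum _ fun k _ =>
        ((meas_mulVec _ k).comp (measurable_pi_apply _)).mul
          ((meas_mulVec _ k).comp (measurable_pi_apply _))
  have hsum : ∑ p ∈ A ×ˢ B, w p.1 * wb p.2 = 1 := by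
    rw [Finset.sum_product, ← Finset.sum_mul_sum, hws, hwbs, one_mul]
  have hlow : ∀ R : Fin N → Matrix.orthogonalGroup (Fin d) ℝ,
      w s * wb s + ∑ p ∈ A ×ˢ B, w p.1 * wb p.2 * g p R ≤
        ip (∑ i ∈ A, w i • (R i : Matrix (Fin d) (Fin d) ℝ).mulVec (x i))
          (∑ i ∈ B, wb i • (R i : Matrix (Fin d) (Fin d) ℝ).mulVec (xb i)) := by
    intro R
    rw [ip_sum_sum]
    have h1 : w s * wb s = ∑ p ∈ A ×ˢ B, if p = (s, s) then w s * wb s else 0 := by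
      rw [Finset.sum_ite_eq' , if_pos (Finset.mk_mem_product hsA hsB)]
    rw [h1, ← Finset.sum_add_distrib]
    apply Finset.sum_le_sum
    rintro ⟨i, j⟩ hp
    obtain ⟨hi, hj⟩ := Finset.mem_product.1 hp
    dsimp only at hi hj ⊢
    by_cases hij : i = j
    · subst hij
      have hg : g (i, i) R = 0 := by simp [g]
      rw [hg, ip_mulVec_mulVec]
      by_cases his : i = s
      · subst his
        have : ip (x i) (xb i) = 1 := by
          rw [← hs, ip_eq_dot, ← sqNorm_eq_dot, hx i hi]
        simp [this]
      · have : (i, i) ≠ (s, s) := by simpa using his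
        rw [if_neg this, mul_zero, add_zero]
        exact mul_nonneg (mul_nonneg (hw _) (hwb _))
          (Finset.sum_nonneg fun k _ => mul_nonneg (hx0 i hi k) (hxb0 i hj k))
    · have : (i, j) ≠ (s, s) := by
        rintro h; simp only [Prod.mk.injEq] at h; exact hij (h.1.trans h.2.symm)
      simp [g, hij, this]
  set F : (Fin N → Matrix.orthogonalGroup (Fin d) ℝ) → ENNReal := fun R =>
    ∑ p ∈ A ×ˢ B, ENNReal.ofReal (w p.1 * wb p.2) * ENNReal.ofReal (Real.exp (-l * g p R)) with hF
  have hFm : Measurable F :=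
    Finset.measurable_sum _ fun p _ => (hgm p).const_mul _
  have hFint : ∫⁻ R, F R ∂(Measure.pi fun _ : Fin N => μ)
      ≤ ENNReal.ofReal (Real.exp (l ^ 2 / (2 * d))) := by
    rw [hF, lintegral_finsetSum _ fun p _ => (hgm p).const_mul _]
    calc _ ≤ ∑ p ∈ A ×ˢ B, ENNReal.ofReal (w p.1 * wb p.2) *
          ENNReal.ofReal (Real.exp (l ^ 2 / (2 * d))) := by
          apply Finset.sum_le_sum
          intro p hp
          obtain ⟨hi, hj⟩ := Finset.mem_product.1 hp
          rw [lintegral_const_mul _ (hgm p)]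
          gcongr
          by_cases hij : p.1 = p.2
          · simp only [g, hij, if_true, mul_zero, Real.exp_zero, ENNReal.ofReal_one,
              lintegral_const, measure_univ, mul_one]
            rw [← ENNReal.ofReal_one]
            exact ENNReal.ofReal_le_ofReal (Real.one_le_exp (by positivity))
          · simp only [g, hij, if_false]
            have := mgf_pair hd μ (-l) _ _ (hx _ hi) (hxb _ hj) p.1 p.2 hij
            rwa [neg_sq] at this
      _ = _ := by
          rw [← Finset.sum_mul, ← ENNReal.ofReal_sum_of_nonneg
            fun p _ => mul_nonneg (hw _) (hwb _), hsum]
          simp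
  have hsub : {R : Fin N → Matrix.orthogonalGroup (Fin d) ℝ |
              ip (∑ i ∈ A, w i • (R i : Matrix (Fin d) (Fin d) ℝ).mulVec (x i))
                  (∑ i ∈ B, wb i • (R i : Matrix (Fin d) (Fin d) ℝ).mulVec (xb i)) <
                w s * wb s - t} ⊆ {R | ENNReal.ofReal (Real.exp (l * t)) ≤ F R} := by
    intro R hR
    rw [Set.mem_ofPred_eq] at hR ⊢
    have h1 : ∑ p ∈ A ×ˢ B, w p.1 * wb p.2 * g p R ≤ -t := by linarith [hlow R]
    have h2 : Real.exp (l * t) ≤ ∑ p ∈ A ×ˢ B, w p.1 * wb p.2 * Real.exp (-l * g p R) := by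
      have hJ := convexOn_exp.map_sum_le (t := A ×ˢ B) (w := fun p => w p.1 * wb p.2)
        (p := fun p => -l * g p R) (fun p _ => mul_nonneg (hw _) (hwb _)) hsum
        (fun _ _ => Set.mem_univ _)
      simp only [smul_eq_mul] at hJ
      refine le_trans (Real.exp_le_exp.2 ?_) hJ
      have : ∑ p ∈ A ×ˢ B, w p.1 * wb p.2 * (-l * g p R)
          = -l * ∑ p ∈ A ×ˢ B, w p.1 * wb p.2 * g p R := by
        rw [Finset.mul_sum]; exact Finset.sum_congr rfl fun p _ => by ring
      rw [this]
      nlinarith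
    rw [hF]
    refine (ENNReal.ofReal_le_ofReal h2).trans (le_of_eq ?_)
    rw [ENNReal.ofReal_sum_of_nonneg fun p _ =>
      mul_nonneg (mul_nonneg (hw _) (hwb _)) (Real.exp_pos _).le]
    exact Finset.sum_congr rfl fun p _ => ENNReal.ofReal_mul (mul_nonneg (hw _) (hwb _))
  refine (measure_mono hsub).trans ?_
  refine (meas_ge_le_lintegral_div hFm.aemeasurable
    (by simp [Real.exp_pos]) ENNReal.ofReal_ne_top).trans ?_
  refine (ENNReal.div_le_div_right hFint _).trans ?_
  rw [← ENNReal.ofReal_div_of_pos (Real.exp_pos _), ← Real.exp_sub, Real.rpow_def_of_pos hN0]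
  apply ENNReal.ofReal_le_ofReal
  apply Real.exp_le_exp.2
  have e : l ^ 2 / (2 * d) = t ^ 2 * d / 2 := by rw [hl]; field_simp
  have e2 : l * t = t ^ 2 * d := by rw [hl]; ring
  rw [e, e2, ht2]; linarith
end

section
/- Prototype B summary statistics, case (i) (frequency recovery, Claim): For every constant k ≥ 1 there exist constants C ≥ 1 and c > 0 such that the following holds. Let N ≥ 2, d ≤ N^k, m ≤ N, and consider the prototype-B sketch s = Σ_{j=1}^m w_j·((I + R_j)/2)·((1/2)R_{M(j),1}x_j + (1/2)R_{M(j),2}e₁) with all matrices independent Haar-random elements of O(d). Let M* be a module index, let n* = #{ j : M(j) = M* } be the number of objects produced by M*, and suppose every object j with M(j) = M* has the same weight w_j = w* > 0. Then Pr[ | (4/w*)·⟨R_{M*,2}e₁, s⟩ − n* | > C·√(log N)/(w*·√d) ] ≤ N^{−c}. -/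
open MeasureTheory Matrix

/-- The first standard basis vector `e₁ ∈ ℝ^d`. -/
def e1 {d : ℕ} : Fin d → ℝ := fun i => if (i : ℕ) = 0 then 1 else 0

/-- The prototype-B overall sketch
`s = Σ_j w_j·((I + R_j)/2)·((1/2)R_{M(j),1}x_j + (1/2)R_{M(j),2}e₁)`, where `R1 M`/`R2 M` are
the two module matrices of module `M` and `Rt j` is the tuple matrix of object position `j`. -/
noncomputable def sketchB {N d m : ℕ} (M : Fin m → Fin N) (x : Fin m → Fin d → ℝ)
    (w : Fin m → ℝ)
    (R1 R2 : Fin N → Matrix.orthogonalGroup (Fin d) ℝ)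
    (Rt : Fin m → Matrix.orthogonalGroup (Fin d) ℝ) : Fin d → ℝ :=
  ∑ j, w j • ((2⁻¹ : ℝ) • (1 + (Rt j : Matrix (Fin d) (Fin d) ℝ))).mulVec
    ((2⁻¹ : ℝ) • (R1 (M j) : Matrix (Fin d) (Fin d) ℝ).mulVec (x j) +
      (2⁻¹ : ℝ) • (R2 (M j) : Matrix (Fin d) (Fin d) ℝ).mulVec e1)

lemma measurable_entryO {d : ℕ} (i j : Fin d) :
    Measurable fun R : Matrix.orthogonalGroup (Fin d) ℝ => (R : Matrix (Fin d) (Fin d) ℝ) i j :=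
  (continuous_subtype_val.matrix_elem i j).measurable

lemma measurable_mv {Ω : Type*} [MeasurableSpace Ω] {d : ℕ}
    {φ : Ω → Matrix.orthogonalGroup (Fin d) ℝ} (hφ : Measurable φ)
    {V : Ω → Fin d → ℝ} (hV : Measurable V) :
    Measurable fun ω => (φ ω : Matrix (Fin d) (Fin d) ℝ).mulVec (V ω) := by
  refine measurable_pi_lambda _ fun i => ?_
  simp only [mulVec, dotProduct]
  exact Finset.measurable_sum _ fun j _ =>
    ((measurable_entryO i j).comp hφ).mul ((measurable_pi_apply j).comp hV)

lemma measurable_dot {Ω : Type*} [MeasurableSpace Ω] {d : ℕ}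
    {U V : Ω → Fin d → ℝ} (hU : Measurable U) (hV : Measurable V) :
    Measurable fun ω => U ω ⬝ᵥ V ω := by
  simp only [dotProduct]
  exact Finset.measurable_sum _ fun j _ =>
    ((measurable_pi_apply j).comp hU).mul ((measurable_pi_apply j).comp hV)

lemma measurable_ee {Ω : Type*} [MeasurableSpace Ω] {f : Ω → ℝ} (hf : Measurable f) (s : ℝ) :
    Measurable fun ω => ENNReal.ofReal (Real.exp (s * f ω)) :=
  (Real.measurable_exp.comp (hf.const_mul s)).ennreal_ofReal

lemma dot_mv {d : ℕ} (A : Matrix (Fin d) (Fin d) ℝ) (u v : Fin d → ℝ) :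
    u ⬝ᵥ A.mulVec v = Aᵀ.mulVec u ⬝ᵥ v := by
  rw [dotProduct_mulVec, mulVec_transpose]

lemma orth_tm {d : ℕ} (R : Matrix.orthogonalGroup (Fin d) ℝ) :
    (R : Matrix (Fin d) (Fin d) ℝ)ᵀ * (R : Matrix (Fin d) (Fin d) ℝ) = 1 :=
  (Matrix.mem_orthogonalGroup_iff' _ _).1 R.2

lemma unit_mv {d : ℕ} (R : Matrix.orthogonalGroup (Fin d) ℝ) {v : Fin d → ℝ} (hv : v ⬝ᵥ v = 1) :
    (R : Matrix (Fin d) (Fin d) ℝ).mulVec v ⬝ᵥ (R : Matrix (Fin d) (Fin d) ℝ).mulVec v = 1 := by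
  rw [dot_mv, mulVec_mulVec, orth_tm, one_mulVec, hv]

/-- Householder: the orthogonal group acts transitively on unit vectors. -/
lemma exists_orth {d : ℕ} {u a : Fin d → ℝ} (hu : u ⬝ᵥ u = 1) (ha : a ⬝ᵥ a = 1) :
    ∃ Q : Matrix.orthogonalGroup (Fin d) ℝ, (Q : Matrix (Fin d) (Fin d) ℝ)ᵀ.mulVec u = a := by
  by_cases h : u = a
  · exact ⟨1, by simp [h]⟩
  set z := u - a with hz
  have hz0 : z ≠ 0 := sub_ne_zero.2 h
  have hc : z ⬝ᵥ z ≠ 0 := fun h0 => hz0 (dotProduct_self_eq_zero.1 h0)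
  set c := z ⬝ᵥ z with hcdef
  set Q : Matrix (Fin d) (Fin d) ℝ := 1 - (2 / c) • vecMulVec z z with hQ
  have hT : Qᵀ = Q := by
    rw [hQ, transpose_sub, transpose_one, transpose_smul, transpose_vecMulVec]
  have hzz : vecMulVec z z * vecMulVec z z = c • vecMulVec z z := by
    rw [vecMulVec_mul_vecMulVec, ← hcdef]
    ext i j; simp [vecMulVec_apply]; ring
  have hQQ : Q * Qᵀ = 1 := by
    rw [hT, hQ, sub_mul, one_mul, mul_sub, mul_one, smul_mul_smul_comm, hzz, smul_smul]
    have : 2 / c * (2 / c) * c = 2 / c + 2 / c := by field_simp; ring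
    rw [this, add_smul]; abel
  refine ⟨⟨Q, (Matrix.mem_orthogonalGroup_iff _ _).2 hQQ⟩, ?_⟩
  show Qᵀ.mulVec u = a
  rw [hT, hQ, sub_mulVec, one_mulVec, smul_mulVec, vecMulVec_mulVec]
  have hc2 : c = 2 * (z ⬝ᵥ u) := by
    rw [hcdef, hz]
    simp only [sub_dotProduct, dotProduct_sub, hu, ha, dotProduct_comm u a]
    ring
  have hzu : z ⬝ᵥ u = c / 2 := by rw [hc2]; ring
  rw [hzu]
  ext i
  simp [hz]
  field_simp
  ring

lemma sum_signs {d : ℕ} (y : Fin d → ℝ) :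
    ∑ ε : Fin d → Bool, Real.exp ((fun i => if ε i then (1:ℝ) else -1) ⬝ᵥ y)
      ≤ 2 ^ d * Real.exp ((y ⬝ᵥ y) / 2) := by
  have h1 : ∑ ε : Fin d → Bool, Real.exp ((fun i => if ε i then (1:ℝ) else -1) ⬝ᵥ y)
      = ∏ i, ∑ b : Bool, Real.exp ((if b then (1:ℝ) else -1) * y i) := by
    rw [Finset.prod_univ_sum, Fintype.piFinset_univ]
    refine Finset.sum_congr rfl fun ε _ => ?_
    rw [dotProduct, Real.exp_sum]
  rw [h1]
  calc _ ≤ ∏ i, (2 * Real.exp (y i ^ 2 / 2)) := by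
        refine Finset.prod_le_prod (fun i _ => by positivity) fun i _ => ?_
        have := Real.cosh_le_exp_half_sq (y i)
        rw [Real.cosh_eq] at this
        simp only [Fintype.sum_bool]
        simp
        linarith
    _ = _ := by
        rw [Finset.prod_mul_distrib, ← Real.exp_sum, ← Finset.sum_div]
        simp [dotProduct, sq]

lemma haar_mgf {d : ℕ} (μ : Measure (Matrix.orthogonalGroup (Fin d) ℝ)) [μ.IsHaarMeasure]
    [IsProbabilityMeasure μ] {u v : Fin d → ℝ} (hu : u ⬝ᵥ u = 1) (hv : v ⬝ᵥ v = 1) (s : ℝ) :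
    ∫⁻ R, ENNReal.ofReal (Real.exp (s * (u ⬝ᵥ (R : Matrix (Fin d) (Fin d) ℝ).mulVec v))) ∂μ
      ≤ ENNReal.ofReal (Real.exp (s ^ 2 / (2 * d))) := by
  have hd : 0 < d := by
    rcases Nat.eq_zero_or_pos d with rfl | h
    · simp at hu
    · exact h
  have hd' : (0:ℝ) < d := by exact_mod_cast hd
  set I := ∫⁻ R, ENNReal.ofReal
    (Real.exp (s * (u ⬝ᵥ (R : Matrix (Fin d) (Fin d) ℝ).mulVec v))) ∂μ with hI
  let sg : (Fin d → Bool) → Fin d → ℝ := fun ε i => if ε i then (1:ℝ) else -1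
  have hsg : ∀ ε, sg ε ⬝ᵥ sg ε = d := by
    intro ε
    have : ∀ i, sg ε i * sg ε i = 1 := by intro i; simp only [sg]; split_ifs <;> norm_num
    simp [dotProduct, this]
  have key : ∀ ε : Fin d → Bool, I = ∫⁻ R, ENNReal.ofReal
      (Real.exp (sg ε ⬝ᵥ ((s / √d) • (R : Matrix (Fin d) (Fin d) ℝ).mulVec v))) ∂μ := by
    intro ε
    have ha : ((√d)⁻¹ • sg ε) ⬝ᵥ ((√d)⁻¹ • sg ε) = 1 := by
      rw [smul_dotProduct, dotProduct_smul, hsg, smul_eq_mul, smul_eq_mul]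
      have : √(d:ℝ) * √d = d := Real.mul_self_sqrt hd'.le
      have h0 : √(d:ℝ) ≠ 0 := (Real.sqrt_pos.2 hd').ne'
      field_simp
      linarith
    obtain ⟨Q, hQ⟩ := exists_orth hu ha
    rw [hI, ← lintegral_mul_left_eq_self _ Q]
    refine lintegral_congr fun R => ?_
    congr 2
    rw [show ((Q * R : Matrix.orthogonalGroup (Fin d) ℝ) : Matrix (Fin d) (Fin d) ℝ) =
      (Q : Matrix (Fin d) (Fin d) ℝ) * R from rfl, ← mulVec_mulVec, dot_mv, hQ,
      smul_dotProduct, dotProduct_smul, smul_eq_mul, smul_eq_mul]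
    ring
  have h2 : (2:ENNReal) ^ d * I ≤ 2 ^ d * ENNReal.ofReal (Real.exp (s ^ 2 / (2 * d))) := by
    calc (2:ENNReal) ^ d * I = ∑ ε : Fin d → Bool, I := by simp
      _ = ∑ ε : Fin d → Bool, ∫⁻ R, ENNReal.ofReal
          (Real.exp (sg ε ⬝ᵥ ((s / √d) • (R : Matrix (Fin d) (Fin d) ℝ).mulVec v))) ∂μ :=
          Finset.sum_congr rfl fun ε _ => key ε
      _ = ∫⁻ R, ∑ ε : Fin d → Bool, ENNReal.ofReal
          (Real.exp (sg ε ⬝ᵥ ((s / √d) • (R : Matrix (Fin d) (Fin d) ℝ).mulVec v))) ∂μ := by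
          rw [lintegral_finsetSum]
          intro ε _
          refine (Real.measurable_exp.comp (measurable_dot measurable_const ?_)).ennreal_ofReal
          have hm : Measurable fun R : Matrix.orthogonalGroup (Fin d) ℝ =>
              (R : Matrix (Fin d) (Fin d) ℝ).mulVec v :=
            measurable_mv measurable_id measurable_const
          exact hm.const_smul (s / √d)
      _ ≤ ∫⁻ R, 2 ^ d * ENNReal.ofReal (Real.exp (s ^ 2 / (2 * d))) ∂μ := by
          refine lintegral_mono fun R => ?_
          rw [← ENNReal.ofReal_sum_of_nonneg fun _ _ => (Real.exp_pos _).le]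
          refine (ENNReal.ofReal_le_ofReal (sum_signs _)).trans ?_
          rw [ENNReal.ofReal_mul (by positivity), ENNReal.ofReal_pow (by norm_num)]
          rw [smul_dotProduct, dotProduct_smul, unit_mv R hv, smul_eq_mul, smul_eq_mul]
          have : s / √(d:ℝ) * (s / √d * 1) / 2 = s ^ 2 / (2 * d) := by
            have : √(d:ℝ) ^ 2 = d := Real.sq_sqrt hd'.le
            have h0 : √(d:ℝ) ≠ 0 := (Real.sqrt_pos.2 hd').ne'
            rw [← this]
            field_simp
            try simp
          rw [this]
          simp
      _ = _ := by simp
  exact (ENNReal.mul_le_mul_iff_right (by simp) (by simp)).1 h2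

lemma chernoff {Ω ι : Type*} [MeasurableSpace Ω] [Fintype ι] (P : Measure Ω)
    (w : ι → ℝ) (hw : ∀ i, 0 ≤ w i) (hw1 : ∑ i, w i = 1) (T : ι → Ω → ℝ)
    (hT : ∀ i, Measurable (T i)) (K s t : ℝ) (hs : 0 ≤ s)
    (h1 : ∀ i, ∫⁻ ω, ENNReal.ofReal (Real.exp (s * T i ω)) ∂P ≤ ENNReal.ofReal K)
    (h2 : ∀ i, ∫⁻ ω, ENNReal.ofReal (Real.exp (-s * T i ω)) ∂P ≤ ENNReal.ofReal K) :
    P {ω | t < |∑ i, w i * T i ω|} ≤ ENNReal.ofReal (Real.exp (-(s * t))) *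
      (2 * ENNReal.ofReal K) := by
  let F : Ω → ENNReal := fun ω => ∑ i, ENNReal.ofReal (w i) *
    (ENNReal.ofReal (Real.exp (s * T i ω)) + ENNReal.ofReal (Real.exp (-s * T i ω)))
  have hadd : ∀ i, Measurable fun ω => ENNReal.ofReal (Real.exp (s * T i ω)) +
      ENNReal.ofReal (Real.exp (-s * T i ω)) := fun i =>
    (measurable_ee (hT i) s).add (measurable_ee (hT i) (-s))
  have hFm : Measurable F := Finset.measurable_sum _ fun i _ => (hadd i).const_mul _
  have hF : ∫⁻ ω, F ω ∂P ≤ 2 * ENNReal.ofReal K := by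
    simp only [F]
    rw [lintegral_finsetSum _ fun i _ => (hadd i).const_mul _]
    calc _ ≤ ∑ i, ENNReal.ofReal (w i) * (2 * ENNReal.ofReal K) := by
          refine Finset.sum_le_sum fun i _ => ?_
          rw [lintegral_const_mul _ (hadd i),
            lintegral_add_left (measurable_ee (hT i) s), two_mul]
          gcongr
          · exact h1 i
          · exact h2 i
      _ = _ := by
          rw [← Finset.sum_mul, ← ENNReal.ofReal_sum_of_nonneg fun i _ => hw i, hw1]; simp
  have jen : ∀ (r : ℝ) (ω : Ω), Real.exp (r * ∑ i, w i * T i ω) ≤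
      ∑ i, w i * Real.exp (r * T i ω) := by
    intro r ω
    have := convexOn_exp.map_sum_le (t := Finset.univ) (w := w) (p := fun i => r * T i ω)
      (fun i _ => hw i) hw1 (fun _ _ => Set.mem_univ _)
    simp only [smul_eq_mul] at this
    refine le_trans (le_of_eq ?_) this
    congr 1
    rw [Finset.mul_sum]
    exact Finset.sum_congr rfl fun _ _ => by ring
  have hsub : {ω | t < |∑ i, w i * T i ω|} ⊆
      {ω | ENNReal.ofReal (Real.exp (s * t)) ≤ F ω} := by
    intro ω hω
    simp only [Set.mem_ofPred_eq] at hω ⊢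
    have hFe : F ω = ENNReal.ofReal (∑ i, w i * Real.exp (s * T i ω) +
        ∑ i, w i * Real.exp (-s * T i ω)) := by
      rw [← Finset.sum_add_distrib, ENNReal.ofReal_sum_of_nonneg fun i _ => by
        have := hw i; positivity]
      refine Finset.sum_congr rfl fun i _ => ?_
      rw [← mul_add, ENNReal.ofReal_mul (hw i), ENNReal.ofReal_add (Real.exp_pos _).le
        (Real.exp_pos _).le]
    rw [hFe]
    refine ENNReal.ofReal_le_ofReal ?_
    have j1 := jen s ω
    have j2 := jen (-s) ω
    have p1 := Real.exp_pos (s * ∑ i, w i * T i ω)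
    have p2 := Real.exp_pos (-s * ∑ i, w i * T i ω)
    rcases lt_abs.1 hω with h | h
    · have := Real.exp_le_exp.2 (mul_le_mul_of_nonneg_left h.le hs)
      linarith
    · have := Real.exp_le_exp.2 (mul_le_mul_of_nonneg_left h.le hs)
      rw [mul_neg, ← neg_mul] at this
      linarith
  calc _ ≤ P {ω | ENNReal.ofReal (Real.exp (s * t)) ≤ F ω} := measure_mono hsub
    _ = ENNReal.ofReal (Real.exp (-(s * t))) * (ENNReal.ofReal (Real.exp (s * t)) *
        P {ω | ENNReal.ofReal (Real.exp (s * t)) ≤ F ω}) := by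
        rw [← mul_assoc, ← ENNReal.ofReal_mul (Real.exp_pos _).le, ← Real.exp_add]; simp
    _ ≤ _ := by
        refine mul_le_mul_right ?_ _
        exact (mul_meas_ge_le_lintegral hFm _).trans hF

lemma prod_le_right {α β : Type*} [MeasurableSpace α] [MeasurableSpace β] (P : Measure α)
    (Q : Measure β) [IsProbabilityMeasure P] [IsProbabilityMeasure Q] {f : α × β → ENNReal}
    (hf : Measurable f) {K : ENNReal} (h : ∀ a, ∫⁻ b, f (a, b) ∂Q ≤ K) :
    ∫⁻ z, f z ∂(P.prod Q) ≤ K := by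
  rw [lintegral_prod _ hf.aemeasurable]
  exact (lintegral_mono h).trans (by simp)

lemma prod_le_left {α β : Type*} [MeasurableSpace α] [MeasurableSpace β] (P : Measure α)
    (Q : Measure β) [IsProbabilityMeasure P] [IsProbabilityMeasure Q] {f : α × β → ENNReal}
    (hf : Measurable f) {K : ENNReal} (h : ∀ b, ∫⁻ a, f (a, b) ∂P ≤ K) :
    ∫⁻ z, f z ∂(P.prod Q) ≤ K := by
  rw [lintegral_prod_symm _ hf.aemeasurable]
  exact (lintegral_mono h).trans (by simp)

lemma pi_mgf {ι : Type*} [Fintype ι] {d : ℕ} (μ : Measure (Matrix.orthogonalGroup (Fin d) ℝ))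
    [μ.IsHaarMeasure] [IsProbabilityMeasure μ] {u v : Fin d → ℝ} (hu : u ⬝ᵥ u = 1)
    (hv : v ⬝ᵥ v = 1) (s : ℝ) (i : ι) :
    ∫⁻ R, ENNReal.ofReal (Real.exp (s * (u ⬝ᵥ (R i : Matrix (Fin d) (Fin d) ℝ).mulVec v)))
      ∂(Measure.pi fun _ : ι => μ) ≤ ENNReal.ofReal (Real.exp (s ^ 2 / (2 * d))) := by
  have hm : Measurable fun R : Matrix.orthogonalGroup (Fin d) ℝ =>
      ENNReal.ofReal (Real.exp (s * (u ⬝ᵥ (R : Matrix (Fin d) (Fin d) ℝ).mulVec v))) :=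
    measurable_ee (measurable_dot measurable_const
      (measurable_mv measurable_id measurable_const)) s
  have := (measurePreserving_eval (fun _ : ι => μ) i).lintegral_comp hm
  exact (le_of_eq this).trans (haar_mgf μ hu hv s)

lemma pi_mgf_pair {ι : Type*} [Fintype ι] {d : ℕ}
    (μ : Measure (Matrix.orthogonalGroup (Fin d) ℝ))
    [μ.IsHaarMeasure] [IsProbabilityMeasure μ] {u v : Fin d → ℝ} (hu : u ⬝ᵥ u = 1)
    (hv : v ⬝ᵥ v = 1) (s : ℝ) {i j : ι} (hij : i ≠ j) :
    ∫⁻ R, ENNReal.ofReal (Real.exp (s * ((R i : Matrix (Fin d) (Fin d) ℝ).mulVec u ⬝ᵥ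
        (R j : Matrix (Fin d) (Fin d) ℝ).mulVec v)))
      ∂(Measure.pi fun _ : ι => μ) ≤ ENNReal.ofReal (Real.exp (s ^ 2 / (2 * d))) := by
  classical
  have hm : Measurable fun z : Matrix.orthogonalGroup (Fin d) ℝ ×
      Matrix.orthogonalGroup (Fin d) ℝ =>
      ENNReal.ofReal (Real.exp (s * ((z.1 : Matrix (Fin d) (Fin d) ℝ).mulVec u ⬝ᵥ
        (z.2 : Matrix (Fin d) (Fin d) ℝ).mulVec v))) :=
    measurable_ee (measurable_dot (measurable_mv measurable_fst measurable_const)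
      (measurable_mv measurable_snd measurable_const)) s
  have hind := (ProbabilityTheory.iIndepFun_pi (μ := fun _ : ι => μ)
    (X := fun _ R => R) (fun _ => aemeasurable_id)).indepFun hij
  rw [ProbabilityTheory.indepFun_iff_map_prod_eq_prod_map_map
    (measurable_pi_apply i).aemeasurable (measurable_pi_apply j).aemeasurable] at hind
  have e1 : Measure.map (fun R : ι → Matrix.orthogonalGroup (Fin d) ℝ => R i)
    (Measure.pi fun _ : ι => μ) = μ := (measurePreserving_eval (fun _ : ι => μ) i).map_eq
  have e2 : Measure.map (fun R : ι → Matrix.orthogonalGroup (Fin d) ℝ => R j)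
    (Measure.pi fun _ : ι => μ) = μ := (measurePreserving_eval (fun _ : ι => μ) j).map_eq
  rw [e1, e2] at hind
  have hl := lintegral_map (μ := Measure.pi fun _ : ι => μ) hm
    (g := fun R : ι → Matrix.orthogonalGroup (Fin d) ℝ => (R i, R j))
    ((measurable_pi_apply i).prodMk (measurable_pi_apply j))
  rw [hind] at hl
  refine (le_of_eq hl.symm).trans ?_
  exact prod_le_right μ μ hm fun S => haar_mgf μ (unit_mv S hu) hv s

lemma e1_unit {d : ℕ} (hd : 0 < d) : (e1 : Fin d → ℝ) ⬝ᵥ e1 = 1 := by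
  obtain ⟨n, rfl⟩ : ∃ n, d = n + 1 := ⟨d - 1, by omega⟩
  simp [dotProduct, e1, Fin.sum_univ_succ]

/-- The noise terms of the estimate. -/
noncomputable def noiseT {N d m : ℕ} (M : Fin m → Fin N) (x : Fin m → Fin d → ℝ) (Ms : Fin N)
    (p : Fin m × Fin 4)
    (ω : (Fin N → Matrix.orthogonalGroup (Fin d) ℝ) ×
                (Fin N → Matrix.orthogonalGroup (Fin d) ℝ) ×
                (Fin m → Matrix.orthogonalGroup (Fin d) ℝ)) : ℝ :=
  4 * (![(ω.2.1 Ms : Matrix (Fin d) (Fin d) ℝ).mulVec e1 ⬝ᵥ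
      (ω.1 (M p.1) : Matrix (Fin d) (Fin d) ℝ).mulVec (x p.1),
    (ω.2.1 Ms : Matrix (Fin d) (Fin d) ℝ).mulVec e1 ⬝ᵥ
      (ω.2.2 p.1 : Matrix (Fin d) (Fin d) ℝ).mulVec
        ((ω.1 (M p.1) : Matrix (Fin d) (Fin d) ℝ).mulVec (x p.1)),
    if M p.1 = Ms then 0 else (ω.2.1 Ms : Matrix (Fin d) (Fin d) ℝ).mulVec e1 ⬝ᵥ
      (ω.2.1 (M p.1) : Matrix (Fin d) (Fin d) ℝ).mulVec e1,
    (ω.2.1 Ms : Matrix (Fin d) (Fin d) ℝ).mulVec e1 ⬝ᵥ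
      (ω.2.2 p.1 : Matrix (Fin d) (Fin d) ℝ).mulVec
        ((ω.2.1 (M p.1) : Matrix (Fin d) (Fin d) ℝ).mulVec e1)] p.2)

lemma noiseT_measurable {N d m : ℕ} (M : Fin m → Fin N) (x : Fin m → Fin d → ℝ) (Ms : Fin N)
    (p : Fin m × Fin 4) : Measurable (noiseT M x Ms p) := by
  obtain ⟨j, i⟩ := p
  have m1 : ∀ a : Fin N, Measurable fun ω : (Fin N → Matrix.orthogonalGroup (Fin d) ℝ) ×
                (Fin N → Matrix.orthogonalGroup (Fin d) ℝ) ×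
                (Fin m → Matrix.orthogonalGroup (Fin d) ℝ) => ω.1 a := by
    intro a; fun_prop
  have m2 : ∀ a : Fin N, Measurable fun ω : (Fin N → Matrix.orthogonalGroup (Fin d) ℝ) ×
                (Fin N → Matrix.orthogonalGroup (Fin d) ℝ) ×
                (Fin m → Matrix.orthogonalGroup (Fin d) ℝ) => ω.2.1 a := by
    intro a; fun_prop
  have m3 : ∀ a : Fin m, Measurable fun ω : (Fin N → Matrix.orthogonalGroup (Fin d) ℝ) ×
                (Fin N → Matrix.orthogonalGroup (Fin d) ℝ) ×
                (Fin m → Matrix.orthogonalGroup (Fin d) ℝ) => ω.2.2 a := by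
    intro a; fun_prop
  have hu := measurable_mv (m2 Ms) (measurable_const (a := (e1 : Fin d → ℝ)))
  have hx := measurable_mv (m1 (M j)) (measurable_const (a := x j))
  have he := measurable_mv (m2 (M j)) (measurable_const (a := (e1 : Fin d → ℝ)))
  unfold noiseT
  refine Measurable.const_mul ?_ _
  fin_cases i
  · exact measurable_dot hu hx
  · exact measurable_dot hu (measurable_mv (m3 j) hx)
  · by_cases h : M j = Ms
    · simp [h]
    · simpa [h] using measurable_dot hu he
  · exact measurable_dot hu (measurable_mv (m3 j) he)

lemma noiseT_mgf {N d m : ℕ} (M : Fin m → Fin N) (x : Fin m → Fin d → ℝ) (hd : 0 < d)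
    (hx : ∀ j, x j ⬝ᵥ x j = 1) (Ms : Fin N)
    (p : Fin m × Fin 4) (μ : Measure (Matrix.orthogonalGroup (Fin d) ℝ))
    [μ.IsHaarMeasure] [IsProbabilityMeasure μ] (s : ℝ) :
    ∫⁻ ω, ENNReal.ofReal (Real.exp (s * noiseT M x Ms p ω)) ∂((Measure.pi fun _ : Fin N => μ).prod
            ((Measure.pi fun _ : Fin N => μ).prod (Measure.pi fun _ : Fin m => μ)))
      ≤ ENNReal.ofReal (Real.exp ((s * 4) ^ 2 / (2 * d))) := by
  have hm := measurable_ee (noiseT_measurable M x Ms p) s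
  have he := e1_unit hd
  obtain ⟨j, i⟩ := p
  fin_cases i
  · refine prod_le_left _ _ hm fun b => ?_
    refine (le_of_eq ?_).trans (pi_mgf μ (unit_mv (b.1 Ms) he) (hx j) (s * 4) (M j))
    exact lintegral_congr fun ω => by simp [noiseT, mul_assoc]
  · refine prod_le_right _ _ hm fun a => prod_le_right _ _ (hm.comp measurable_prodMk_left)
      fun b => ?_
    refine (le_of_eq ?_).trans (pi_mgf μ (unit_mv (b Ms) he) (unit_mv (a (M j)) (hx j)) (s * 4) j)
    exact lintegral_congr fun ω => by simp [noiseT, mul_assoc]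
  · by_cases h : M j = Ms
    · simp only [noiseT, h]
      simp
      positivity
    · refine prod_le_right _ _ hm fun a => prod_le_left _ _ (hm.comp measurable_prodMk_left)
        fun b => ?_
      refine (le_of_eq ?_).trans (pi_mgf_pair μ he he (s * 4) (Ne.symm h))
      exact lintegral_congr fun ω => by simp [noiseT, mul_assoc, h]
  · refine prod_le_right _ _ hm fun a => prod_le_right _ _ (hm.comp measurable_prodMk_left)
      fun b => ?_
    refine (le_of_eq ?_).trans (pi_mgf μ (unit_mv (b Ms) he) (unit_mv (b (M j)) he) (s * 4) j)
    exact lintegral_congr fun ω => by simp [noiseT, mul_assoc]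

lemma estimate_eq {N d m : ℕ} (M : Fin m → Fin N) (x : Fin m → Fin d → ℝ) (hd : 0 < d)
    (w : Fin m → ℝ) (Ms : Fin N) (ws : ℝ) (hws : 0 < ws) (hw : ∀ j, M j = Ms → w j = ws)
    (ω : (Fin N → Matrix.orthogonalGroup (Fin d) ℝ) ×
                (Fin N → Matrix.orthogonalGroup (Fin d) ℝ) ×
                (Fin m → Matrix.orthogonalGroup (Fin d) ℝ)) :
    (4 / ws) * ip ((ω.2.1 Ms : Matrix (Fin d) (Fin d) ℝ).mulVec e1)
                      (sketchB M x w ω.1 ω.2.1 ω.2.2) -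
                  (Finset.univ.filter fun j => M j = Ms).card
      = ws⁻¹ * ∑ p : Fin m × Fin 4, (w p.1 / 4) * noiseT M x Ms p ω := by
  have hip : ∀ u v : Fin d → ℝ, ip u v = u ⬝ᵥ v := fun _ _ => rfl
  rw [hip, sketchB, dotProduct_sum, Finset.card_filter, Fintype.sum_prod_type, Finset.mul_sum,
    Finset.mul_sum, Nat.cast_sum, ← Finset.sum_sub_distrib]
  refine Finset.sum_congr rfl fun j _ => ?_
  have hu := unit_mv (ω.2.1 Ms) (e1_unit hd)
  simp only [Fin.sum_univ_four, noiseT]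
  simp only [dotProduct_smul, smul_mulVec, add_mulVec, one_mulVec, mulVec_add, mulVec_smul,
    dotProduct_add, smul_eq_mul]
  by_cases h : M j = Ms
  · simp [h, hw j h, hu]
    field_simp
    ring
  · simp [h]
    field_simp
    ring

/-- **Prototype B summary statistics, case (i): frequency recovery.** For every constant
`k ≥ 1` there are constants `C ≥ 1`, `c > 0` such that: with all module matrices and tuple
matrices independent Haar-random orthogonal matrices, if every object produced by module `M⋆`
has the same weight `w⋆ > 0` and `n⋆` is the number of such objects, then
`Pr[ |(4/w⋆)·⟨R_{M⋆,2}e₁, s⟩ − n⋆| > C·√(log N)/(w⋆·√d) ] ≤ N^{−c}`. -/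
theorem prototypeB_frequency_recovery (k : ℕ) (hk : 1 ≤ k) :
    ∃ C : ℝ, 1 ≤ C ∧ ∃ c : ℝ, 0 < c ∧
      ∀ (N d m : ℕ), 2 ≤ N → d ≤ N ^ k → m ≤ N →
      ∀ M : Fin m → Fin N,
      ∀ x : Fin m → Fin d → ℝ, (∀ j, sqNorm (x j) = 1) →
      ∀ w : Fin m → ℝ, (∀ j, 0 ≤ w j) → (∑ j, w j) = 1 →
      ∀ μ : Measure (Matrix.orthogonalGroup (Fin d) ℝ),
        μ.IsHaarMeasure → IsProbabilityMeasure μ →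
      ∀ (Mstar : Fin N) (wstar : ℝ), 0 < wstar →
        (∀ j, M j = Mstar → w j = wstar) →
        (((Measure.pi fun _ : Fin N => μ).prod
            ((Measure.pi fun _ : Fin N => μ).prod (Measure.pi fun _ : Fin m => μ)))
            {ω : (Fin N → Matrix.orthogonalGroup (Fin d) ℝ) ×
                (Fin N → Matrix.orthogonalGroup (Fin d) ℝ) ×
                (Fin m → Matrix.orthogonalGroup (Fin d) ℝ) |
              C * Real.sqrt (Real.log N) / (wstar * Real.sqrt d) <
                |(4 / wstar) *
                    ip ((ω.2.1 Mstar : Matrix (Fin d) (Fin d) ℝ).mulVec e1)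
                      (sketchB M x w ω.1 ω.2.1 ω.2.2) -
                  (Finset.univ.filter fun j => M j = Mstar).card|})
          ≤ ENNReal.ofReal ((N : ℝ) ^ (-c : ℝ)) := by
  refine ⟨8, by norm_num, 1, by norm_num, ?_⟩
  intro N d m hN _ _ M x hx w hw hw1 μ hμ hP Ms ws hws hwM
  have hx' : ∀ j, x j ⬝ᵥ x j = 1 := fun j => by
    rw [← hx j]; simp [dotProduct, sqNorm, sq]
  have hd : 0 < d := by
    rcases Nat.eq_zero_or_pos d with rfl | h
    · exfalso
      rcases Nat.eq_zero_or_pos m with rfl | h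
      · simp at hw1
      · have := hx' ⟨0, h⟩
        simp at this
    · exact h
  have hd' : (0:ℝ) < d := by exact_mod_cast hd
  have hN' : (2:ℝ) ≤ N := by exact_mod_cast hN
  have hlog : 0 ≤ Real.log N := Real.log_nonneg (by linarith)
  set L := Real.sqrt (Real.log N) with hL
  have hL2 : L ^ 2 = Real.log N := Real.sq_sqrt hlog
  have hL0 : 0 ≤ L := Real.sqrt_nonneg _
  set D := Real.sqrt (d : ℝ) with hD
  have hD2 : D ^ 2 = d := Real.sq_sqrt hd'.le
  have hD0 : 0 < D := Real.sqrt_pos.2 hd'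
  have hs : 0 ≤ L * D / 2 := by positivity
  have hc := chernoff ((Measure.pi fun _ : Fin N => μ).prod
            ((Measure.pi fun _ : Fin N => μ).prod (Measure.pi fun _ : Fin m => μ)))
    (fun p : Fin m × Fin 4 => w p.1 / 4) (fun p => by have := hw p.1; positivity)
    (by
      rw [Fintype.sum_prod_type, ← hw1]
      refine Finset.sum_congr rfl fun j _ => ?_
      simp [Fin.sum_univ_four]; ring)
    (noiseT M x Ms) (noiseT_measurable M x Ms)
    (Real.exp ((L * D / 2 * 4) ^ 2 / (2 * d))) (L * D / 2) (8 * L / D) hs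
    (fun p => noiseT_mgf M x hd hx' Ms p μ _)
    (fun p => by
      have := noiseT_mgf M x hd hx' Ms p μ (-(L * D / 2))
      rwa [neg_mul, neg_sq] at this)
  refine le_trans (measure_mono ?_) (hc.trans ?_)
  · intro ω hω
    simp only [Set.mem_ofPred_eq] at hω ⊢
    rw [estimate_eq M x hd w Ms ws hws hwM ω, abs_mul, abs_of_pos (inv_pos.2 hws)] at hω
    have h2 := mul_lt_mul_of_pos_left hω hws
    rw [← mul_assoc, mul_inv_cancel₀ hws.ne', one_mul] at h2
    refine lt_of_eq_of_lt ?_ h2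
    field_simp
  · have h2 : (2 : ENNReal) = ENNReal.ofReal 2 := by simp
    rw [h2, ← ENNReal.ofReal_mul (by norm_num), ← ENNReal.ofReal_mul (Real.exp_pos _).le]
    refine ENNReal.ofReal_le_ofReal ?_
    have hNpos : (0:ℝ) < N := by linarith
    have e1 : -(L * D / 2 * (8 * L / D)) = -(4 * Real.log N) := by
      rw [← hL2]; field_simp; ring
    have e2 : (L * D / 2 * 4) ^ 2 / (2 * d) = 2 * Real.log N := by
      rw [← hL2, ← hD2]; field_simp; ring
    rw [e1, e2, Real.rpow_def_of_pos hNpos]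
    calc Real.exp (-(4 * Real.log N)) * (2 * Real.exp (2 * Real.log N))
        ≤ Real.exp (-(4 * Real.log N)) * (Real.exp (Real.log N) * Real.exp (2 * Real.log N)) := by
          rw [Real.exp_log hNpos]; gcongr
      _ = Real.exp (Real.log N * -1) := by
          rw [← Real.exp_add, ← Real.exp_add]; congr 1; ring
end
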